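/- arXiv:1808.01825 — 5 statements merged into one kernel-verified Lean document; each statement's English description precedes it below -/
import Mathlib

section
/- Let Ω be a separable metric space and let 𝒫 be a nonempty compact set of Borel probability measures on Ω, where the space of Borel probability measures carries the topology of weak convergence. Let (f_n)_{n≥1} be bounded continuous real-valued functions on Ω decreasing pointwise to a bounded continuous function f. Then sup_{P∈𝒫} ∫ f_n dP decreases to sup_{P∈𝒫} ∫ f dP as n → ∞. -/
open MeasureTheory Filter Topology BoundedContinuousFunction

/-- **Downward convergence of upper expectations over a weakly compact family of measures.**
Let `Ω` be a separable metric space and `𝔓` a nonempty compact set of Borel probability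
measures on `Ω` (in the topology of weak convergence).  If bounded continuous functions `fₙ`
decrease pointwise to a bounded continuous function `g`, then
`sup_{P ∈ 𝔓} ∫ fₙ dP` decreases to `sup_{P ∈ 𝔓} ∫ g dP` as `n → ∞`. -/
theorem upperExpectation_downward_convergence
    {Ω : Type*} [MetricSpace Ω] [TopologicalSpace.SeparableSpace Ω]
    [MeasurableSpace Ω] [BorelSpace Ω]
    (𝔓 : Set (ProbabilityMeasure Ω)) (hne : 𝔓.Nonempty) (hcpt : IsCompact 𝔓)
    (f : ℕ → (Ω →ᵇ ℝ)) (g : Ω →ᵇ ℝ)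
    (hanti : ∀ ω, Antitone fun n => f n ω)
    (hlim : ∀ ω, Tendsto (fun n => f n ω) atTop (𝓝 (g ω))) :
    Antitone (fun n =>
        sSup ((fun P : ProbabilityMeasure Ω => ∫ ω, f n ω ∂(P : Measure Ω)) '' 𝔓)) ∧
      Tendsto
        (fun n =>
          sSup ((fun P : ProbabilityMeasure Ω => ∫ ω, f n ω ∂(P : Measure Ω)) '' 𝔓))
        atTop
        (𝓝 (sSup ((fun P : ProbabilityMeasure Ω => ∫ ω, g ω ∂(P : Measure Ω)) '' 𝔓))) := by
  have hcont : ∀ h : Ω →ᵇ ℝ,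
      Continuous (fun P : ProbabilityMeasure Ω => ∫ ω, h ω ∂(P : Measure Ω)) :=
    fun h => ProbabilityMeasure.continuous_integral_boundedContinuousFunction h
  have hbdd : ∀ h : Ω →ᵇ ℝ,
      BddAbove ((fun P : ProbabilityMeasure Ω => ∫ ω, h ω ∂(P : Measure Ω)) '' 𝔓) :=
    fun h => (hcpt.image (hcont h)).bddAbove
  have hint : ∀ (h : Ω →ᵇ ℝ) (P : ProbabilityMeasure Ω), Integrable h (P : Measure Ω) :=
    fun h P => h.integrable _
  have hA : ∀ P : ProbabilityMeasure Ω, Antitone fun n => ∫ ω, f n ω ∂(P : Measure Ω) :=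
    fun P m n hmn => integral_mono (hint _ P) (hint _ P) fun ω => hanti ω hmn
  have hT : ∀ P : ProbabilityMeasure Ω, Tendsto (fun n => ∫ ω, f n ω ∂(P : Measure Ω)) atTop
      (𝓝 (∫ ω, g ω ∂(P : Measure Ω))) := fun P =>
    integral_tendsto_of_tendsto_of_antitone (fun n => hint _ P) (hint _ P)
      (Eventually.of_forall hanti) (Eventually.of_forall hlim)
  refine ⟨?_, ?_⟩
  · intro m n hmn
    refine csSup_le (hne.image _) ?_
    rintro _ ⟨P, hP, rfl⟩
    exact (hA P hmn).trans (le_csSup (hbdd (f m)) ⟨P, hP, rfl⟩)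
  · have hU := Antitone.tendstoUniformlyOn_of_forall_tendsto hcpt
      (fun n => (hcont (f n)).continuousOn) (fun P _ => hA P) (hcont g).continuousOn
      (fun P _ => hT P)
    rw [Metric.tendstoUniformlyOn_iff] at hU
    rw [Metric.tendsto_atTop']
    intro ε hε
    obtain ⟨N, hN⟩ := eventually_atTop.1 (hU (ε / 2) (half_pos hε))
    refine ⟨N, fun n hn => ?_⟩
    have hn := hN n hn.le
    have h1 : sSup ((fun P : ProbabilityMeasure Ω => ∫ ω, f n ω ∂(P : Measure Ω)) '' 𝔓) ≤
        sSup ((fun P : ProbabilityMeasure Ω => ∫ ω, g ω ∂(P : Measure Ω)) '' 𝔓) + ε / 2 := by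
      refine csSup_le (hne.image _) ?_
      rintro _ ⟨P, hP, rfl⟩
      have h2 := le_csSup (hbdd g) ⟨P, hP, rfl⟩
      have h3 := hn P hP
      rw [Real.dist_eq, abs_lt] at h3
      dsimp only at h2 h3 ⊢
      linarith
    have h4 : sSup ((fun P : ProbabilityMeasure Ω => ∫ ω, g ω ∂(P : Measure Ω)) '' 𝔓) ≤
        sSup ((fun P : ProbabilityMeasure Ω => ∫ ω, f n ω ∂(P : Measure Ω)) '' 𝔓) := by
      refine csSup_le (hne.image _) ?_
      rintro _ ⟨P, hP, rfl⟩
      exact ((hA P).le_of_tendsto (hT P) n).trans (le_csSup (hbdd (f n)) ⟨P, hP, rfl⟩)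
    rw [Real.dist_eq, abs_lt]
    constructor <;> linarith
end

section
/- Let 𝕊(d) denote the real vector space of symmetric d×d real matrices, with the order A ≥ A' meaning A − A' is positive semidefinite, and let 𝕊₊(d) denote the set of positive semidefinite matrices in 𝕊(d). Let Γ ⊆ 𝕊₊(d) be nonempty and bounded, define G(A) := (1/2) sup_{γ∈Γ} tr(γA) for A ∈ 𝕊(d), and let σ² > 0. Then the following are equivalent: (i) G(A) − G(A') ≥ (1/2) σ² tr(A − A') for all A, A' ∈ 𝕊(d) with A ≥ A'; (ii) γ ≥ σ² I_{d×d} for every γ ∈ Γ, where I_{d×d} is the d×d identity matrix. -/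
open Matrix

theorem aux_bdd {d : ℕ} (Γ : Set (Matrix (Fin d) (Fin d) ℝ))
    (hbdd : ∃ C : ℝ, ∀ γ ∈ Γ, ∀ i j, |γ i j| ≤ C) (A : Matrix (Fin d) (Fin d) ℝ) :
    BddAbove ((fun γ : Matrix (Fin d) (Fin d) ℝ => (γ * A).trace) '' Γ) := by
  obtain ⟨C, hC⟩ := hbdd
  refine ⟨∑ i, ∑ j, C * |A j i|, ?_⟩
  rintro _ ⟨γ, hγ, rfl⟩
  simp only [Matrix.trace, Matrix.diag_apply, Matrix.mul_apply]
  refine Finset.sum_le_sum fun i _ => Finset.sum_le_sum fun j _ => ?_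
  calc γ i j * A j i ≤ |γ i j * A j i| := le_abs_self _
    _ = |γ i j| * |A j i| := abs_mul _ _
    _ ≤ C * |A j i| := mul_le_mul_of_nonneg_right (hC γ hγ i j) (abs_nonneg _)

theorem aux_trace {d : ℕ} {P Q : Matrix (Fin d) (Fin d) ℝ} (hP : P.PosSemidef)
    (hQ : Q.PosSemidef) : 0 ≤ (P * Q).trace := by
  obtain ⟨R, rfl⟩ : ∃ R : Matrix (Fin d) (Fin d) ℝ, Q = Rᴴ * R := by
    open scoped MatrixOrder in
    exact CStarAlgebra.nonneg_iff_eq_star_mul_self.mp hQ.nonneg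
  rw [← Matrix.mul_assoc, Matrix.trace_mul_comm, ← Matrix.mul_assoc]
  exact (hP.mul_mul_conjTranspose_same R).trace_nonneg

/-- **Characterization of non-degeneracy of `G`.**
Let `Γ` be a nonempty bounded set of positive semidefinite `d × d` real matrices, let
`G A := (1/2) · sup_{γ ∈ Γ} tr (γ A)` and let `σ² > 0`.  Then the non-degeneracy condition
`G A − G A' ≥ (1/2) σ² tr (A − A')` for all symmetric `A ≥ A'` holds if and only if
`γ ≥ σ² I` for every `γ ∈ Γ`. -/
theorem nondegenerate_iff_uniformly_elliptic
    (d : ℕ) (Γ : Set (Matrix (Fin d) (Fin d) ℝ))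
    (hne : Γ.Nonempty)
    (hpsd : ∀ γ ∈ Γ, γ.PosSemidef)
    (hbdd : ∃ C : ℝ, ∀ γ ∈ Γ, ∀ i j, |γ i j| ≤ C)
    (σsq : ℝ) (hσ : 0 < σsq) :
    (∀ A B : Matrix (Fin d) (Fin d) ℝ, A.IsSymm → B.IsSymm → (A - B).PosSemidef →
        (1 / 2) * σsq * (A - B).trace ≤
          (1 / 2) * sSup ((fun γ : Matrix (Fin d) (Fin d) ℝ => (γ * A).trace) '' Γ) -
            (1 / 2) * sSup ((fun γ : Matrix (Fin d) (Fin d) ℝ => (γ * B).trace) '' Γ))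
      ↔ ∀ γ ∈ Γ, (γ - σsq • (1 : Matrix (Fin d) (Fin d) ℝ)).PosSemidef := by
  constructor
  · intro h γ hγ
    refine Matrix.PosSemidef.of_dotProduct_mulVec_nonneg ?_ ?_
    · exact (hpsd γ hγ).isHermitian.sub (by simp [Matrix.IsHermitian])
    · intro v
      have h1 := h 0 (-vecMulVec v v) (by simp [Matrix.IsSymm])
        (by simp [Matrix.IsSymm, Matrix.transpose_vecMulVec])
        (by simpa using Matrix.posSemidef_vecMulVec_self_star v)
      have h2 := le_csSup (aux_bdd Γ hbdd (-vecMulVec v v)) ⟨γ, hγ, rfl⟩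
      have h3 : sSup ((fun γ : Matrix (Fin d) (Fin d) ℝ =>
          (γ * (0 : Matrix (Fin d) (Fin d) ℝ)).trace) '' Γ) = 0 := by
        simp [hne.image_const]
      rw [h3] at h1
      simp only [zero_sub, neg_neg, Matrix.mul_neg, Matrix.trace_neg, Matrix.mul_vecMulVec,
        Matrix.trace_vecMulVec] at h1 h2
      simp only [star_trivial, Matrix.sub_mulVec, Matrix.smul_mulVec, Matrix.one_mulVec,
        dotProduct_sub, dotProduct_smul, smul_eq_mul]
      rw [dotProduct_comm v (γ *ᵥ v)]
      linarith
  · intro h A B _ _ hAB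
    have key : sSup ((fun γ : Matrix (Fin d) (Fin d) ℝ => (γ * B).trace) '' Γ) ≤
        sSup ((fun γ : Matrix (Fin d) (Fin d) ℝ => (γ * A).trace) '' Γ)
          - σsq * (A - B).trace := by
      refine csSup_le (hne.image _) ?_
      rintro _ ⟨γ, hγ, rfl⟩
      have h2 := le_csSup (aux_bdd Γ hbdd A) ⟨γ, hγ, rfl⟩
      have h4 := aux_trace (h γ hγ) hAB
      rw [Matrix.sub_mul, Matrix.trace_sub, Matrix.smul_mul, Matrix.one_mul, Matrix.trace_smul,
        Matrix.mul_sub, Matrix.trace_sub, smul_eq_mul] at h4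
      simp only at h2 ⊢
      linarith
    linarith
end

section
/- Let 𝒫 be a nonempty collection of probability measures on a measurable space (Ω, ℱ) and let 𝔼̂[X] := sup_{P∈𝒫} E_P[X] denote the upper expectation. For each ε > 0 let Z_ε : Ω → [0, ∞) be measurable with Z_ε^k P-integrable for every P ∈ 𝒫 and every positive integer k. Assume that for every positive integer r, 𝔼̂[Z_ε^r] → 1 and 𝔼̂[−Z_ε^r] → −1 as ε ↓ 0. Then for every even positive integer N, 𝔼̂[(Z_ε − 1)^N] → 0 as ε ↓ 0. -/
open MeasureTheory Filter Topology

/-- **Binomial-expansion convergence for upper expectations.**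
Let `𝔓` be a nonempty collection of probability measures on `Ω` and
`𝔼̂[X] := sup_{P ∈ 𝔓} E_P[X]`.  For each `ε > 0` let `Z_ε ≥ 0` be measurable with all
positive integer powers `P`-integrable for every `P ∈ 𝔓`.  If `𝔼̂[Z_ε^r] → 1` and
`𝔼̂[−Z_ε^r] → −1` as `ε ↓ 0` for every positive integer `r`, then for every even positive
integer `N`, `𝔼̂[(Z_ε − 1)^N] → 0` as `ε ↓ 0`. -/
theorem upperExpectation_binomial_convergence
    {Ω : Type*} [MeasurableSpace Ω]
    (𝔓 : Set (Measure Ω)) (hne : 𝔓.Nonempty)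
    (hprob : ∀ P ∈ 𝔓, IsProbabilityMeasure P)
    (Z : ℝ → Ω → ℝ)
    (hZmeas : ∀ ε : ℝ, 0 < ε → Measurable (Z ε))
    (hZ0 : ∀ ε : ℝ, 0 < ε → ∀ ω, 0 ≤ Z ε ω)
    (hZint : ∀ ε : ℝ, 0 < ε → ∀ P ∈ 𝔓, ∀ k : ℕ, 0 < k →
      Integrable (fun ω => (Z ε ω) ^ k) P)
    (hpos : ∀ r : ℕ, 0 < r →
      Tendsto (fun ε : ℝ => sSup ((fun P : Measure Ω => ∫ ω, (Z ε ω) ^ r ∂P) '' 𝔓))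
        (𝓝[>] 0) (𝓝 1))
    (hneg : ∀ r : ℕ, 0 < r →
      Tendsto (fun ε : ℝ => sSup ((fun P : Measure Ω => ∫ ω, -((Z ε ω) ^ r) ∂P) '' 𝔓))
        (𝓝[>] 0) (𝓝 (-1))) :
    ∀ N : ℕ, 0 < N → Even N →
      Tendsto (fun ε : ℝ => sSup ((fun P : Measure Ω => ∫ ω, (Z ε ω - 1) ^ N ∂P) '' 𝔓))
        (𝓝[>] 0) (𝓝 0) := by
  intro N hN hev
  set S : ℕ → ℝ → ℝ := fun r ε => sSup ((fun P : Measure Ω => ∫ ω, (Z ε ω) ^ r ∂P) '' 𝔓) with hS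
  set T : ℕ → ℝ → ℝ := fun r ε => sSup ((fun P : Measure Ω => ∫ ω, -((Z ε ω) ^ r) ∂P) '' 𝔓) with hT
  set D : ℕ → ℝ → ℝ := fun k ε => if k = 0 then 0 else |S k ε - 1| + |T k ε + 1| with hD
  have hDlim : ∀ k, Tendsto (D k) (𝓝[>] 0) (𝓝 0) := by
    intro k
    by_cases hk : k = 0
    · simp [hD, hk]
    · have h1 := ((hpos k (Nat.pos_of_ne_zero hk)).sub_const 1).abs
      have h2 := ((hneg k (Nat.pos_of_ne_zero hk)).add_const 1).abs
      have h3 := h1.add h2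
      simp only [hD, hk, if_false]
      simpa using h3
  have hU : Tendsto (fun ε => ∑ k ∈ Finset.range (N + 1), (N.choose k : ℝ) * D k ε)
      (𝓝[>] 0) (𝓝 0) := by
    have := tendsto_finsetSum (Finset.range (N + 1))
      (fun k _ => (hDlim k).const_mul (N.choose k : ℝ))
    simpa using this
  have hbdd : ∀ᶠ ε in 𝓝[>] (0 : ℝ), ∀ k ∈ Finset.range (N + 1), 0 < k →
      BddAbove ((fun P : Measure Ω => ∫ ω, (Z ε ω) ^ k ∂P) '' 𝔓) := by
    rw [Filter.eventually_all_finset]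
    intro k _
    by_cases hk : 0 < k
    · filter_upwards [(hpos k hk).eventually (lt_mem_nhds (zero_lt_one))] with ε hε _
      by_contra hb
      rw [Real.sSup_of_not_bddAbove hb] at hε
      exact lt_irrefl _ hε
    · exact Eventually.of_forall fun _ h => absurd h hk
  have hpt : ∀ ε, 0 < ε → ∀ P ∈ 𝔓, 0 ≤ ∫ ω, (Z ε ω - 1) ^ N ∂P := by
    intro ε _ P _
    exact integral_nonneg fun ω => hev.pow_nonneg _
  refine tendsto_of_tendsto_of_tendsto_of_le_of_le' tendsto_const_nhds hU ?_ ?_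
  · filter_upwards [self_mem_nhdsWithin] with ε hε
    apply Real.sSup_nonneg
    rintro _ ⟨P, hP, rfl⟩
    exact hpt ε hε P hP
  · filter_upwards [self_mem_nhdsWithin, hbdd] with ε hε hb
    have hε' : 0 < ε := hε
    apply csSup_le (hne.image _)
    rintro _ ⟨P, hP, rfl⟩
    haveI := hprob P hP
    have hint : ∀ k, Integrable (fun ω => (Z ε ω) ^ k) P := by
      intro k
      by_cases hk : k = 0
      · simp [hk]
      · exact hZint ε hε' P hP k (Nat.pos_of_ne_zero hk)
    have hdev : ∀ k ∈ Finset.range (N + 1), |(∫ ω, (Z ε ω) ^ k ∂P) - 1| ≤ D k ε := by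
      intro k hkm
      by_cases hk : k = 0
      · simp [hk, hD]
      · have hk' := Nat.pos_of_ne_zero hk
        have h1 : ∫ ω, (Z ε ω) ^ k ∂P ≤ S k ε := le_csSup (hb k hkm hk') ⟨P, hP, rfl⟩
        have h2 : ∫ ω, -((Z ε ω) ^ k) ∂P ≤ T k ε := by
          refine le_csSup ⟨0, ?_⟩ ⟨P, hP, rfl⟩
          rintro _ ⟨Q, _, rfl⟩
          exact integral_nonpos fun ω => neg_nonpos.2 (pow_nonneg (hZ0 ε hε' ω) k)
        rw [integral_neg] at h2
        simp only [hD, hk, if_false]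
        rw [abs_le]
        constructor
        · linarith [le_abs_self (T k ε + 1), abs_nonneg (S k ε - 1)]
        · linarith [le_abs_self (S k ε - 1), abs_nonneg (T k ε + 1)]
    have hexp : ∫ ω, (Z ε ω - 1) ^ N ∂P = ∑ k ∈ Finset.range (N + 1),
        ((-1) ^ (N - k) * (N.choose k : ℝ)) * ∫ ω, (Z ε ω) ^ k ∂P := by
      simp_rw [← integral_const_mul]
      rw [← integral_finsetSum _ fun k _ => (hint k).const_mul _]
      congr 1
      ext ω
      rw [sub_eq_add_neg, add_pow]
      exact Finset.sum_congr rfl fun k _ => by ring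
    have hzero : ∑ k ∈ Finset.range (N + 1), ((-1) ^ (N - k) * (N.choose k : ℝ)) = 0 := by
      have := add_pow (1 : ℝ) (-1) N
      simp only [one_pow, one_mul, add_neg_cancel] at this
      rw [← this, zero_pow hN.ne']
    have heq : ∫ ω, (Z ε ω - 1) ^ N ∂P = ∑ k ∈ Finset.range (N + 1),
        ((-1) ^ (N - k) * (N.choose k : ℝ)) * ((∫ ω, (Z ε ω) ^ k ∂P) - 1) := by
      simp_rw [mul_sub, mul_one]
      rw [Finset.sum_sub_distrib, hzero, sub_zero, hexp]
    show ∫ ω, (Z ε ω - 1) ^ N ∂P ≤ _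
    rw [heq]
    apply Finset.sum_le_sum
    intro k hk
    refine (le_abs_self _).trans ?_
    rw [abs_mul, abs_mul, abs_pow, abs_neg, abs_one, one_pow, one_mul, Nat.abs_cast]
    exact mul_le_mul_of_nonneg_left (hdev k hk) (Nat.cast_nonneg _)
end

section
/- Let 𝒫 be a nonempty collection of probability measures on a measurable space (Ω, ℱ) and let 𝔼̂[X] := sup_{P∈𝒫} E_P[X] denote the upper expectation. Let S, Q : Ω → ℝ be measurable with Q ≥ 0, and assume: (i) there exists δ₀ > 0 such that 𝔼̂[exp(δ₀ Q)] < ∞; (ii) there exists r₀ > 0 such that for every r ∈ ℝ with |r| ≤ r₀, exp(rS − (r²/2)Q) is P-integrable for every P ∈ 𝒫 and 𝔼̂[exp(rS − (r²/2)Q)] = 1; (iii) S is P-integrable with E_P[S] = 0 for every P ∈ 𝒫. Fix α, β ∈ ℝ and for ε > 0 set J_ε := exp(αεS − (βε²/2)Q). Then 𝔼̂[J_ε] → 1 and 𝔼̂[−J_ε] → −1 as ε ↓ 0. -/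
open MeasureTheory Filter Topology
open scoped ENNReal

lemma aux_exp (x : ℝ) : |Real.exp x - 1 - x| ≤ x ^ 2 * Real.exp |x| := by
  have h := Complex.norm_exp_sub_sum_le_norm_mul_exp (x : ℂ) 2
  have e : (Complex.exp x - ∑ m ∈ Finset.range 2, (x : ℂ) ^ m / (m.factorial : ℂ))
      = ((Real.exp x - 1 - x : ℝ) : ℂ) := by
    simp [Finset.sum_range_succ]; ring
  rw [e, Complex.norm_real, Complex.norm_real] at h
  simpa using h

/-- pointwise domination -/
lemma aux_point (α β c ε s q : ℝ) (hq : 0 ≤ q) (hc : 0 < c) (hε : 0 < ε) (hε1 : ε ≤ 1)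
    (hεc : ε ≤ c) (δ : ℝ) (hδ : 2 * ((2 * c * |α|) ^ 2 + c * |β|) ≤ δ) :
    |Real.exp (α * ε * s - β * ε ^ 2 / 2 * q) - 1 - α * ε * s| ≤
      ε ^ 2 * ((1 / c + 2 / c ^ 2) *
        (Real.exp ((4 * c * |α|) * s - (4 * c * |α|) ^ 2 / 2 * q) +
         Real.exp ((-(4 * c * |α|)) * s - (-(4 * c * |α|)) ^ 2 / 2 * q) +
         Real.exp (δ * q))) := by
  set x := α * ε * s - β * ε ^ 2 / 2 * q with hx
  set Y := |α| * |s| + |β| / 2 * q with hY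
  have hY0 : 0 ≤ Y := by positivity
  have hxY : |x| ≤ ε * Y := by
    have h1 : |x| ≤ |α * ε * s| + |β * ε ^ 2 / 2 * q| := abs_sub _ _
    have h2 : |α * ε * s| = ε * (|α| * |s|) := by
      rw [abs_mul, abs_mul, abs_of_pos hε]; ring
    have h3 : |β * ε ^ 2 / 2 * q| = ε ^ 2 * (|β| / 2 * q) := by
      rw [abs_mul, abs_div, abs_mul, abs_of_nonneg hq, abs_of_pos (by positivity : 0 < ε ^ 2),
        abs_of_pos (by norm_num : (0:ℝ) < 2)]; ring
    have h4 : ε ^ 2 * (|β| / 2 * q) ≤ ε * (|β| / 2 * q) := by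
      apply mul_le_mul_of_nonneg_right _ (by positivity)
      nlinarith
    rw [hY]; linarith
  have hE := aux_exp x
  have hβ : |β * ε ^ 2 / 2 * q| ≤ ε ^ 2 * Y := by
    have h3 : |β * ε ^ 2 / 2 * q| = ε ^ 2 * (|β| / 2 * q) := by
      rw [abs_mul, abs_div, abs_mul, abs_of_nonneg hq, abs_of_pos (by positivity : 0 < ε ^ 2),
        abs_of_pos (by norm_num : (0:ℝ) < 2)]; ring
    rw [h3]
    apply mul_le_mul_of_nonneg_left _ (by positivity)
    rw [hY]
    have : 0 ≤ |α| * |s| := by positivity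
    linarith
  have hA : |Real.exp x - 1 - α * ε * s| ≤ ε ^ 2 * Y + x ^ 2 * Real.exp |x| := by
    have : Real.exp x - 1 - α * ε * s = (Real.exp x - 1 - x) - β * ε ^ 2 / 2 * q := by
      rw [hx]; ring
    rw [this]
    exact (abs_sub _ _).trans (by linarith)
  have hx2 : x ^ 2 ≤ ε ^ 2 * Y ^ 2 := by
    rw [← sq_abs x, ← mul_pow]
    exact pow_le_pow_left₀ (abs_nonneg _) hxY 2
  have hex : Real.exp |x| ≤ Real.exp (c * Y) :=
    Real.exp_le_exp.2 (hxY.trans (mul_le_mul_of_nonneg_right hεc hY0))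
  have hcY : 0 ≤ c * Y := by positivity
  have hY1 : Y ≤ 1 / c * Real.exp (c * Y) := by
    rw [div_mul_eq_mul_div, le_div_iff₀ hc]
    have := Real.add_one_le_exp (c * Y)
    linarith
  have hY2 : Y ^ 2 ≤ 2 / c ^ 2 * Real.exp (c * Y) := by
    rw [div_mul_eq_mul_div, le_div_iff₀ (by positivity)]
    have := Real.quadratic_le_exp_of_nonneg hcY
    nlinarith
  have h1e : 1 ≤ Real.exp (c * Y) := Real.one_le_exp hcY
  have hB : ε ^ 2 * Y + x ^ 2 * Real.exp |x| ≤
      ε ^ 2 * ((1 / c + 2 / c ^ 2) * Real.exp (2 * (c * Y))) := by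
    have e2 : Real.exp (2 * (c * Y)) = Real.exp (c * Y) * Real.exp (c * Y) := by
      rw [← Real.exp_add]; ring_nf
    have k1 : x ^ 2 * Real.exp |x| ≤
        ε ^ 2 * (2 / c ^ 2 * Real.exp (c * Y)) * Real.exp (c * Y) := by
      apply mul_le_mul _ hex (Real.exp_pos _).le (by positivity)
      exact hx2.trans (mul_le_mul_of_nonneg_left hY2 (by positivity))
    have k2 : ε ^ 2 * Y ≤ ε ^ 2 * (1 / c * (Real.exp (c * Y) * Real.exp (c * Y))) := by
      apply mul_le_mul_of_nonneg_left _ (by positivity)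
      refine hY1.trans (mul_le_mul_of_nonneg_left ?_ (by positivity))
      nlinarith
    rw [e2]
    linarith
  have hG : Real.exp (2 * (c * Y)) ≤
        (Real.exp ((4 * c * |α|) * s - (4 * c * |α|) ^ 2 / 2 * q) +
         Real.exp ((-(4 * c * |α|)) * s - (-(4 * c * |α|)) ^ 2 / 2 * q) +
         Real.exp (δ * q)) := by
    set a := 2 * c * |α| with ha
    have ea : 4 * c * |α| = 2 * a := by rw [ha]; ring
    rw [ea]
    set u := a * |s| - a ^ 2 * q with hu
    set v := (a ^ 2 + c * |β|) * q with hv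
    have e1 : 2 * (c * Y) = u + v := by rw [hu, hv, hY, ha]; ring
    have e3 : Real.exp (u + v) ≤ Real.exp (2 * u) + Real.exp (2 * v) := by
      have p1 : Real.exp (2 * u) = Real.exp u ^ 2 := by rw [← Real.exp_nat_mul]; norm_num
      have p2 : Real.exp (2 * v) = Real.exp v ^ 2 := by rw [← Real.exp_nat_mul]; norm_num
      rw [Real.exp_add, p1, p2]
      nlinarith [sq_nonneg (Real.exp u - Real.exp v), sq_nonneg (Real.exp u + Real.exp v)]
    have e4 : Real.exp (2 * v) ≤ Real.exp (δ * q) := by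
      apply Real.exp_le_exp.2
      rw [hv, ← mul_assoc]
      exact mul_le_mul_of_nonneg_right hδ hq
    have e5 : Real.exp (2 * u) ≤ Real.exp ((2 * a) * s - (2 * a) ^ 2 / 2 * q) +
         Real.exp ((-(2 * a)) * s - (-(2 * a)) ^ 2 / 2 * q) := by
      rcases abs_cases s with ⟨h, _⟩ | ⟨h, _⟩
      · have : 2 * u = (2 * a) * s - (2 * a) ^ 2 / 2 * q := by rw [hu, h]; ring
        rw [this]
        linarith [Real.exp_pos ((-(2 * a)) * s - (-(2 * a)) ^ 2 / 2 * q)]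
      · have : 2 * u = (-(2 * a)) * s - (-(2 * a)) ^ 2 / 2 * q := by rw [hu, h]; ring
        rw [this]
        linarith [Real.exp_pos ((2 * a) * s - (2 * a) ^ 2 / 2 * q)]
    rw [e1]; linarith
  refine hA.trans (hB.trans ?_)
  gcongr

/-- **Convergence of perturbed exponential martingale expectations (Proposition 3.1).**
Let `𝔓` be a nonempty collection of probability measures on `Ω` and
`𝔼̂[X] := sup_{P ∈ 𝔓} E_P[X]`.  Let `S, Q` be measurable with `Q ≥ 0` such that:
(i) `𝔼̂[exp (δ₀ Q)] < ∞` for some `δ₀ > 0`;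
(ii) for some `r₀ > 0` and all `|r| ≤ r₀`, the exponential `exp (r S − (r²/2) Q)` is
`P`-integrable for every `P ∈ 𝔓` with `𝔼̂[exp (r S − (r²/2) Q)] = 1`;
(iii) `S` is `P`-integrable with `E_P[S] = 0` for every `P ∈ 𝔓`.
Then with `J_ε := exp (α ε S − (β ε²/2) Q)`, one has `𝔼̂[J_ε] → 1` and `𝔼̂[−J_ε] → −1` as
`ε ↓ 0`. -/
theorem upperExpectation_exponential_martingale_convergence
    {Ω : Type*} [MeasurableSpace Ω]
    (𝔓 : Set (Measure Ω)) (hne : 𝔓.Nonempty)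
    (hprob : ∀ P ∈ 𝔓, IsProbabilityMeasure P)
    (S Q : Ω → ℝ) (hS : Measurable S) (hQ : Measurable Q) (hQ0 : ∀ ω, 0 ≤ Q ω)
    (h1 : ∃ δ₀ : ℝ, 0 < δ₀ ∧
      (⨆ P ∈ 𝔓, ∫⁻ ω, ENNReal.ofReal (Real.exp (δ₀ * Q ω)) ∂P) < ⊤)
    (h2 : ∃ r₀ : ℝ, 0 < r₀ ∧ ∀ r : ℝ, |r| ≤ r₀ →
      (∀ P ∈ 𝔓, Integrable (fun ω => Real.exp (r * S ω - r ^ 2 / 2 * Q ω)) P) ∧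
      sSup ((fun P : Measure Ω =>
        ∫ ω, Real.exp (r * S ω - r ^ 2 / 2 * Q ω) ∂P) '' 𝔓) = 1)
    (h3 : ∀ P ∈ 𝔓, Integrable S P ∧ ∫ ω, S ω ∂P = 0)
    (α β : ℝ) :
    Tendsto (fun ε : ℝ => sSup ((fun P : Measure Ω =>
        ∫ ω, Real.exp (α * ε * S ω - β * ε ^ 2 / 2 * Q ω) ∂P) '' 𝔓))
      (𝓝[>] 0) (𝓝 1) ∧
    Tendsto (fun ε : ℝ => sSup ((fun P : Measure Ω =>
        ∫ ω, -Real.exp (α * ε * S ω - β * ε ^ 2 / 2 * Q ω) ∂P) '' 𝔓))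
      (𝓝[>] 0) (𝓝 (-1)) := by
  obtain ⟨δ, hδ, hM⟩ := h1
  obtain ⟨r₀, hr₀, h2⟩ := h2
  set M := (⨆ P ∈ 𝔓, ∫⁻ ω, ENNReal.ofReal (Real.exp (δ * Q ω)) ∂P) with hMdef
  have hle1 : ∀ r : ℝ, |r| ≤ r₀ → ∀ P ∈ 𝔓,
      ∫ ω, Real.exp (r * S ω - r ^ 2 / 2 * Q ω) ∂P ≤ 1 := by
    intro r hr P hP
    have hs := (h2 r hr).2
    rw [← hs]
    apply le_csSup
    · by_contra hb
      rw [Real.sSup_of_not_bddAbove hb] at hs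
      norm_num at hs
    · exact ⟨P, hP, rfl⟩
  have hQi : ∀ P ∈ 𝔓, Integrable (fun ω => Real.exp (δ * Q ω)) P ∧
      ∫ ω, Real.exp (δ * Q ω) ∂P ≤ M.toReal := by
    intro P hP
    have hmeas : Measurable (fun ω => Real.exp (δ * Q ω)) := by fun_prop
    have hle : ∫⁻ ω, ENNReal.ofReal (Real.exp (δ * Q ω)) ∂P ≤ M :=
      le_iSup₂ (f := fun (P : Measure Ω) (_ : P ∈ 𝔓) =>
        ∫⁻ ω, ENNReal.ofReal (Real.exp (δ * Q ω)) ∂P) P hP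
    have h0 : 0 ≤ᵐ[P] (fun ω => Real.exp (δ * Q ω)) :=
      Eventually.of_forall fun ω => (Real.exp_pos _).le
    constructor
    · refine ⟨hmeas.aestronglyMeasurable, ?_⟩
      rw [hasFiniteIntegral_iff_ofReal h0]
      exact hle.trans_lt hM
    · rw [integral_eq_lintegral_of_nonneg_ae h0 hmeas.aestronglyMeasurable]
      exact ENNReal.toReal_mono hM.ne hle
  obtain ⟨c, hc, hcr, hcδ⟩ : ∃ c : ℝ, 0 < c ∧ 4 * c * |α| ≤ r₀ ∧
      2 * ((2 * c * |α|) ^ 2 + c * |β|) ≤ δ := by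
    have t1 : Tendsto (fun c : ℝ => 4 * c * |α|) (𝓝[>] 0) (𝓝 0) := by
      have : Continuous (fun c : ℝ => 4 * c * |α|) := by fun_prop
      simpa using (this.tendsto 0).mono_left nhdsWithin_le_nhds
    have t2 : Tendsto (fun c : ℝ => 2 * ((2 * c * |α|) ^ 2 + c * |β|)) (𝓝[>] 0) (𝓝 0) := by
      have : Continuous (fun c : ℝ => 2 * ((2 * c * |α|) ^ 2 + c * |β|)) := by fun_prop
      simpa using (this.tendsto 0).mono_left nhdsWithin_le_nhds
    have := (self_mem_nhdsWithin (a := (0:ℝ)) (s := Set.Ioi 0))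
    obtain ⟨c, h⟩ := (((t1.eventually_le_const hr₀).and (t2.eventually_le_const hδ)).and
      (eventually_mem_nhdsWithin (a := (0:ℝ)) (s := Set.Ioi 0))).exists
    exact ⟨c, h.2, h.1.1, h.1.2⟩
  set r := 4 * c * |α| with hr
  have hr0 : 0 ≤ r := by positivity
  have hra : |r| ≤ r₀ := by rwa [abs_of_nonneg hr0]
  have hra' : |-r| ≤ r₀ := by rwa [abs_neg]
  set K := (1 / c + 2 / c ^ 2) with hK
  have hK0 : 0 < K := by positivity
  set C := K * (1 + 1 + M.toReal) with hC
  have key : ∀ ε : ℝ, 0 < ε → ε ≤ 1 → ε ≤ c → ∀ P ∈ 𝔓,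
      |∫ ω, Real.exp (α * ε * S ω - β * ε ^ 2 / 2 * Q ω) ∂P - 1| ≤ ε ^ 2 * C := by
    intro ε hε hε1 hεc P hP
    haveI := hprob P hP
    set G : Ω → ℝ := fun ω => Real.exp (r * S ω - r ^ 2 / 2 * Q ω) +
         Real.exp ((-r) * S ω - (-r) ^ 2 / 2 * Q ω) + Real.exp (δ * Q ω) with hG
    have i1 := (h2 r hra).1 P hP
    have i2 := (h2 (-r) hra').1 P hP
    have i3 := (hQi P hP).1
    have i12 : Integrable (fun ω => Real.exp (r * S ω - r ^ 2 / 2 * Q ω) +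
         Real.exp ((-r) * S ω - (-r) ^ 2 / 2 * Q ω)) P := i1.add i2
    have iG : Integrable G P := i12.add i3
    have bG : ∫ ω, G ω ∂P ≤ 1 + 1 + M.toReal := by
      rw [hG, integral_add i12 i3, integral_add i1 i2]
      linarith [hle1 r hra P hP, hle1 (-r) hra' P hP, (hQi P hP).2]
    have hpt : ∀ ω, |Real.exp (α * ε * S ω - β * ε ^ 2 / 2 * Q ω) - 1 - α * ε * S ω| ≤
        ε ^ 2 * (K * G ω) := fun ω =>
      aux_point α β c ε (S ω) (Q ω) (hQ0 ω) hc hε hε1 hεc δ hcδ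
    have iD : Integrable (fun ω => ε ^ 2 * (K * G ω)) P := (iG.const_mul K).const_mul _
    have iR : Integrable (fun ω =>
        Real.exp (α * ε * S ω - β * ε ^ 2 / 2 * Q ω) - 1 - α * ε * S ω) P := by
      refine iD.mono' ?_ (Eventually.of_forall hpt)
      exact Measurable.aestronglyMeasurable (by fun_prop)
    have iS : Integrable (fun ω => α * ε * S ω) P := (h3 P hP).1.const_mul _
    have i1S : Integrable (fun ω => 1 + α * ε * S ω) P := (integrable_const 1).add iS
    have eq : ∫ ω, Real.exp (α * ε * S ω - β * ε ^ 2 / 2 * Q ω) ∂P - 1 =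
        ∫ ω, (Real.exp (α * ε * S ω - β * ε ^ 2 / 2 * Q ω) - 1 - α * ε * S ω) ∂P := by
      have : ∫ ω, Real.exp (α * ε * S ω - β * ε ^ 2 / 2 * Q ω) ∂P =
          ∫ ω, ((Real.exp (α * ε * S ω - β * ε ^ 2 / 2 * Q ω) - 1 - α * ε * S ω) +
            (1 + α * ε * S ω)) ∂P := by
        congr 1; ext ω; ring
      rw [this, integral_add iR i1S, integral_add (integrable_const 1) iS,
        integral_const_mul, (h3 P hP).2]
      simp
    rw [eq]
    calc _ ≤ ∫ ω, |Real.exp (α * ε * S ω - β * ε ^ 2 / 2 * Q ω) - 1 - α * ε * S ω| ∂P :=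
          abs_integral_le_integral_abs
      _ ≤ ∫ ω, ε ^ 2 * (K * G ω) ∂P := integral_mono iR.abs iD hpt
      _ = ε ^ 2 * (K * ∫ ω, G ω ∂P) := by rw [integral_const_mul, integral_const_mul]
      _ ≤ ε ^ 2 * C := by rw [hC]; gcongr
  have gen : ∀ (F : ℝ → Measure Ω → ℝ) (l : ℝ),
      (∀ ε : ℝ, 0 < ε → ε ≤ 1 → ε ≤ c → ∀ P ∈ 𝔓, |F ε P - l| ≤ ε ^ 2 * C) →
      Tendsto (fun ε => sSup ((F ε) '' 𝔓)) (𝓝[>] 0) (𝓝 l) := by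
    intro F l hF
    have ev : ∀ᶠ ε : ℝ in 𝓝[>] 0, 0 < ε ∧ ε ≤ 1 ∧ ε ≤ c := by
      filter_upwards [Ioc_mem_nhdsGT (zero_lt_one' ℝ), Ioc_mem_nhdsGT hc] with ε h h'
      exact ⟨h.1, h.2, h'.2⟩
    have t1 : Tendsto (fun ε : ℝ => l - ε ^ 2 * C) (𝓝[>] 0) (𝓝 l) := by
      have : Continuous (fun ε : ℝ => l - ε ^ 2 * C) := by fun_prop
      simpa using (this.tendsto 0).mono_left nhdsWithin_le_nhds
    have t2 : Tendsto (fun ε : ℝ => l + ε ^ 2 * C) (𝓝[>] 0) (𝓝 l) := by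
      have : Continuous (fun ε : ℝ => l + ε ^ 2 * C) := by fun_prop
      simpa using (this.tendsto 0).mono_left nhdsWithin_le_nhds
    have ub : ∀ ε : ℝ, 0 < ε ∧ ε ≤ 1 ∧ ε ≤ c → ∀ y ∈ (F ε) '' 𝔓, y ≤ l + ε ^ 2 * C := by
      rintro ε ⟨h, h', h''⟩ _ ⟨P, hP, rfl⟩
      linarith [(abs_le.1 (hF ε h h' h'' P hP)).2]
    refine tendsto_of_tendsto_of_tendsto_of_le_of_le' t1 t2 ?_ ?_
    · filter_upwards [ev] with ε h
      obtain ⟨P, hP⟩ := hne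
      refine le_trans ?_ (le_csSup ⟨_, ub ε h⟩ ⟨P, hP, rfl⟩)
      linarith [(abs_le.1 (hF ε h.1 h.2.1 h.2.2 P hP)).1]
    · filter_upwards [ev] with ε h
      exact csSup_le (hne.image _) (ub ε h)
  refine ⟨gen _ 1 key, gen (fun ε P =>
    ∫ ω, -Real.exp (α * ε * S ω - β * ε ^ 2 / 2 * Q ω) ∂P) (-1) ?_⟩
  intro ε h h' h'' P hP
  have := key ε h h' h'' P hP
  rw [integral_neg, ← abs_neg]
  convert this using 2
  ring
end

section
/- Let 𝒫 be a nonempty collection of probability measures on a measurable space (Ω, ℱ) and let 𝔼̂[X] := sup_{P∈𝒫} E_P[X] denote the upper expectation. Let X, Y : Ω → [0, ∞) be measurable and suppose there exist δ > 0 and δ₀ > 0 such that 𝔼̂[exp((1/2)(1 + δ)X)] < ∞ and 𝔼̂[exp(δ₀ Y)] < ∞. Then for every δ′ with 0 < δ′ < δ there exists ε₀ > 0 such that for all ε with 0 < ε ≤ ε₀, 𝔼̂[exp((1/2)(1 + δ′)(X + ε²Y))] < ∞. -/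
open MeasureTheory Filter Topology
open scoped ENNReal

/-- **Stability of the Novikov-type exponential moment condition under perturbation
(Lemma 3.4).**
Let `𝔓` be a nonempty collection of probability measures on `Ω` and
`𝔼̂[X] := sup_{P ∈ 𝔓} E_P[X]`.  Let `X, Y ≥ 0` be measurable and suppose
`𝔼̂[exp ((1/2)(1+δ) X)] < ∞` and `𝔼̂[exp (δ₀ Y)] < ∞` for some `δ, δ₀ > 0`.  Then for every
`0 < δ' < δ` there exists `ε₀ > 0` such that for all `0 < ε ≤ ε₀`,
`𝔼̂[exp ((1/2)(1+δ')(X + ε² Y))] < ∞`. -/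
theorem upperExpectation_novikov_stability
    {Ω : Type*} [MeasurableSpace Ω]
    (𝔓 : Set (Measure Ω)) (hne : 𝔓.Nonempty)
    (hprob : ∀ P ∈ 𝔓, IsProbabilityMeasure P)
    (X Y : Ω → ℝ) (hX : Measurable X) (hY : Measurable Y)
    (hX0 : ∀ ω, 0 ≤ X ω) (hY0 : ∀ ω, 0 ≤ Y ω)
    (δ δ₀ : ℝ) (hδ : 0 < δ) (hδ₀ : 0 < δ₀)
    (hXe : (⨆ P ∈ 𝔓, ∫⁻ ω, ENNReal.ofReal
      (Real.exp ((1 / 2) * (1 + δ) * X ω)) ∂P) < ⊤)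
    (hYe : (⨆ P ∈ 𝔓, ∫⁻ ω, ENNReal.ofReal (Real.exp (δ₀ * Y ω)) ∂P) < ⊤) :
    ∀ δ' : ℝ, 0 < δ' → δ' < δ →
      ∃ ε₀ : ℝ, 0 < ε₀ ∧ ∀ ε : ℝ, 0 < ε → ε ≤ ε₀ →
        (⨆ P ∈ 𝔓, ∫⁻ ω, ENNReal.ofReal
          (Real.exp ((1 / 2) * (1 + δ') * (X ω + ε ^ 2 * Y ω))) ∂P) < ⊤ := by
  intro δ' h0 h1
  have hd : 0 < 1 + δ := by linarith
  have hd' : 0 < 1 + δ' := by linarith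
  have hdd : 0 < δ - δ' := by linarith
  set c : ℝ := 2 * ((δ - δ') / (1 + δ) * δ₀) / (1 + δ') with hc
  have hcpos : 0 < c := by positivity
  refine ⟨Real.sqrt c, Real.sqrt_pos.mpr hcpos, fun ε hε hle => ?_⟩
  have hε2 : ε ^ 2 ≤ c := by
    calc ε ^ 2 ≤ (Real.sqrt c) ^ 2 := by gcongr
      _ = c := Real.sq_sqrt hcpos.le
  have key : ∀ ω, (1 / 2) * (1 + δ') * (X ω + ε ^ 2 * Y ω) ≤
      max ((1 / 2) * (1 + δ) * X ω) (δ₀ * Y ω) := by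
    intro ω
    have e1 : (1 / 2) * (1 + δ') * (X ω + c * Y ω) =
        (1 + δ') / (1 + δ) * ((1 / 2) * (1 + δ) * X ω) +
          (δ - δ') / (1 + δ) * (δ₀ * Y ω) := by
      rw [hc]; field_simp
    calc (1 / 2) * (1 + δ') * (X ω + ε ^ 2 * Y ω)
        ≤ (1 / 2) * (1 + δ') * (X ω + c * Y ω) := by
          have := hY0 ω
          gcongr
      _ = _ := e1
      _ ≤ (1 + δ') / (1 + δ) * max ((1 / 2) * (1 + δ) * X ω) (δ₀ * Y ω) +
          (δ - δ') / (1 + δ) * max ((1 / 2) * (1 + δ) * X ω) (δ₀ * Y ω) := by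
          gcongr
          · exact le_max_left _ _
          · exact le_max_right _ _
      _ = max ((1 / 2) * (1 + δ) * X ω) (δ₀ * Y ω) := by
          field_simp
          ring
  refine lt_of_le_of_lt (iSup₂_le fun P hP => ?_) (ENNReal.add_lt_top.mpr ⟨hXe, hYe⟩)
  calc ∫⁻ ω, ENNReal.ofReal (Real.exp ((1 / 2) * (1 + δ') * (X ω + ε ^ 2 * Y ω))) ∂P
      ≤ ∫⁻ ω, (ENNReal.ofReal (Real.exp ((1 / 2) * (1 + δ) * X ω)) +
          ENNReal.ofReal (Real.exp (δ₀ * Y ω))) ∂P := by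
        refine lintegral_mono fun ω => ?_
        rcases le_max_iff.mp (key ω) with h | h
        · exact (ENNReal.ofReal_le_ofReal (Real.exp_le_exp.mpr h)).trans le_self_add
        · exact (ENNReal.ofReal_le_ofReal (Real.exp_le_exp.mpr h)).trans le_add_self
    _ = _ := lintegral_add_left (by fun_prop) _
    _ ≤ _ := add_le_add
        (le_iSup₂ (f := fun (P : Measure Ω) (_ : P ∈ 𝔓) => ∫⁻ ω, ENNReal.ofReal
          (Real.exp ((1 / 2) * (1 + δ) * X ω)) ∂P) P hP)
        (le_iSup₂ (f := fun (P : Measure Ω) (_ : P ∈ 𝔓) => ∫⁻ ω, ENNReal.ofReal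
          (Real.exp (δ₀ * Y ω)) ∂P) P hP)
end
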